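/- Let ρ ∈ (−1,0), let Φ be the standard normal distribution function, let F_L be the standard Laplace distribution function, and let π(x,y) = Φ( (Φ^{←}(F_L(y)) − ρ Φ^{←}(F_L(x))) / (1−ρ²)^{1/2} ) be the transition kernel of the stationary Gaussian Markov chain with correlation ρ transformed to standard Laplace margins. Then assumption C1 is satisfied with a_±(v) = −ρ²v, b_±(v) = |v|^{1/2} and K_− = K_+ = K where K(x) = Φ(x/(2ρ²(1−ρ²))^{1/2}): that is, for every x ∈ ℝ, lim_{v→+∞} π(v, −ρ²v + |v|^{1/2}x) = Φ(x/(2ρ²(1−ρ²))^{1/2}) and lim_{v→−∞} π(v, −ρ²v + |v|^{1/2}x) = Φ(x/(2ρ²(1−ρ²))^{1/2}). -/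

import Mathlib

open MeasureTheory Filter Topology

/-- The standard normal distribution function `Φ`. -/
noncomputable def stdNormalCDF (x : ℝ) : ℝ :=
  ∫ t in Set.Iic x, Real.exp (-t ^ 2 / 2) / Real.sqrt (2 * Real.pi)

/-- The (generalized) inverse `Φ^{←}` of the standard normal distribution function. -/
noncomputable def stdNormalInv (p : ℝ) : ℝ :=
  sInf {x : ℝ | p ≤ stdNormalCDF x}

/-- The standard Laplace distribution function. -/
noncomputable def laplaceCDF (x : ℝ) : ℝ :=
  if x < 0 then Real.exp x / 2 else 1 - Real.exp (-x) / 2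

/-- The Gaussian transition kernel with correlation `ρ`, transformed to standard Laplace
margins: `π(x,y) = Φ((Φ^{←}(F_L(y)) - ρ Φ^{←}(F_L(x)))/(1-ρ²)^{1/2})`. -/
noncomputable def gaussLaplaceKernelCDF (ρ : ℝ) (x y : ℝ) : ℝ :=
  stdNormalCDF
    ((stdNormalInv (laplaceCDF y) - ρ * stdNormalInv (laplaceCDF x)) / Real.sqrt (1 - ρ ^ 2))

lemma integrable_stdNormal_density :
    Integrable (fun t : ℝ => Real.exp (-t ^ 2 / 2) / Real.sqrt (2 * Real.pi)) := by
  have h := (integrable_exp_neg_mul_sq (b := 1 / 2) (by norm_num)).div_const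
    (Real.sqrt (2 * Real.pi))
  refine h.congr (Eventually.of_forall fun t => ?_)
  dsimp only
  ring_nf

lemma integral_stdNormal_density :
    ∫ t : ℝ, Real.exp (-t ^ 2 / 2) / Real.sqrt (2 * Real.pi) = 1 := by
  have h : ∀ t : ℝ, -t ^ 2 / 2 = -(1 / 2) * t ^ 2 := fun t => by ring
  simp_rw [integral_div, h]
  rw [integral_gaussian, show Real.pi / (1 / 2) = 2 * Real.pi by ring]
  exact div_self (by positivity)

lemma stdNormalCDF_sub (a b : ℝ) :
    stdNormalCDF b - stdNormalCDF a =
      ∫ t in a..b, Real.exp (-t ^ 2 / 2) / Real.sqrt (2 * Real.pi) :=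
  intervalIntegral.integral_Iic_sub_Iic integrable_stdNormal_density.integrableOn
    integrable_stdNormal_density.integrableOn

lemma strictMono_stdNormalCDF : StrictMono stdNormalCDF := fun a b hab => by
  rw [← sub_pos, stdNormalCDF_sub]
  exact intervalIntegral.intervalIntegral_pos_of_pos
    integrable_stdNormal_density.intervalIntegrable (fun t => by positivity) hab

lemma continuous_stdNormalCDF : Continuous stdNormalCDF := by
  have h : stdNormalCDF = fun x => stdNormalCDF 0 +
      ∫ t in (0 : ℝ)..x, Real.exp (-t ^ 2 / 2) / Real.sqrt (2 * Real.pi) := by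
    funext x
    rw [← stdNormalCDF_sub]
    ring
  rw [h]
  exact continuous_const.add (intervalIntegral.continuous_primitive
    (fun _ _ => integrable_stdNormal_density.intervalIntegrable) 0)

lemma stdNormalCDF_neg (x : ℝ) : stdNormalCDF (-x) = 1 - stdNormalCDF x := by
  have h := integral_comp_neg_Iic (-x)
    (fun t : ℝ => Real.exp (-t ^ 2 / 2) / Real.sqrt (2 * Real.pi))
  have h' := intervalIntegral.integral_Iic_add_Ioi (b := x) (μ := volume)
    integrable_stdNormal_density.integrableOn integrable_stdNormal_density.integrableOn
  rw [integral_stdNormal_density] at h'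
  simp only [neg_sq, neg_neg] at h
  rw [stdNormalCDF, stdNormalCDF, h]
  linarith

lemma stdNormalCDF_zero : stdNormalCDF 0 = 1 / 2 := by
  have h := stdNormalCDF_neg 0
  rw [neg_zero] at h
  linarith

lemma stdNormalInv_stdNormalCDF (x : ℝ) : stdNormalInv (stdNormalCDF x) = x := by
  have h : {y : ℝ | stdNormalCDF x ≤ stdNormalCDF y} = Set.Ici x := by
    ext y
    exact strictMono_stdNormalCDF.le_iff_le
  rw [stdNormalInv, h, csInf_Ici]

lemma stdNormalCDF_neg_le {s : ℝ} (hs : 0 ≤ s) :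
    stdNormalCDF (-s) ≤ Real.exp (-s ^ 2 / 2) / 2 := by
  have hshift : stdNormalCDF (-s) =
      ∫ t in Set.Iic (0 : ℝ), Real.exp (-(t - s) ^ 2 / 2) / Real.sqrt (2 * Real.pi) := by
    have h := (measurePreserving_add_right (volume : Measure ℝ) (-s)).setIntegral_preimage_emb
      (MeasurableEquiv.addRight (-s)).measurableEmbedding
      (fun t : ℝ => Real.exp (-t ^ 2 / 2) / Real.sqrt (2 * Real.pi)) (Set.Iic (-s))
    rw [Set.preimage_add_const_Iic, sub_self] at h
    simp only [← sub_eq_add_neg] at h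
    exact h.symm
  have hint : Integrable
      (fun t : ℝ => Real.exp (-(t - s) ^ 2 / 2) / Real.sqrt (2 * Real.pi)) :=
    integrable_stdNormal_density.comp_sub_right s
  calc stdNormalCDF (-s)
      ≤ ∫ t in Set.Iic (0 : ℝ), Real.exp (-s ^ 2 / 2) *
          (Real.exp (-t ^ 2 / 2) / Real.sqrt (2 * Real.pi)) := by
        rw [hshift]
        refine setIntegral_mono_on hint.integrableOn
          (integrable_stdNormal_density.const_mul _).integrableOn measurableSet_Iic
          fun t (ht : t ≤ 0) => ?_
        rw [← mul_div_assoc, ← Real.exp_add]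
        gcongr
        nlinarith [mul_nonpos_of_nonpos_of_nonneg ht hs]
    _ = Real.exp (-s ^ 2 / 2) * stdNormalCDF 0 := integral_const_mul _ _
    _ = Real.exp (-s ^ 2 / 2) / 2 := by
        rw [stdNormalCDF_zero]
        ring

lemma mul_density_le_stdNormalCDF {a b : ℝ} (hab : a ≤ b) (hb : b ≤ 0) :
    (b - a) * (Real.exp (-a ^ 2 / 2) / Real.sqrt (2 * Real.pi)) ≤ stdNormalCDF b := by
  have hpos : 0 ≤ stdNormalCDF a :=
    setIntegral_nonneg measurableSet_Iic fun t _ => by positivity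
  have h := intervalIntegral.integral_mono_on (μ := volume) hab
    (f := fun _ => Real.exp (-a ^ 2 / 2) / Real.sqrt (2 * Real.pi))
    intervalIntegrable_const integrable_stdNormal_density.intervalIntegrable
    fun t ht => by
      have hsq : t ^ 2 ≤ a ^ 2 := by nlinarith [ht.1, ht.2]
      gcongr ?_ / _
      exact Real.exp_le_exp.2 (by linarith)
  rw [← stdNormalCDF_sub, intervalIntegral.integral_const, smul_eq_mul] at h
  linarith

/-- The normal score `Φ^{←}(F_L(v))` of a Laplace quantile `v`. -/
noncomputable def laplaceScore (v : ℝ) : ℝ :=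
  stdNormalInv (laplaceCDF v)

lemma laplaceScore_spec {v : ℝ} (hv : 0 < v) :
    stdNormalCDF (-laplaceScore v) = Real.exp (-v) / 2 ∧
      laplaceScore (-v) = -laplaceScore v ∧ laplaceScore v ≤ Real.sqrt (2 * v) := by
  have hs : -Real.sqrt (2 * v) ≤ 0 := neg_nonpos.2 (Real.sqrt_nonneg _)
  have hlow : stdNormalCDF (-Real.sqrt (2 * v)) ≤ Real.exp (-v) / 2 := by
    refine (stdNormalCDF_neg_le (Real.sqrt_nonneg _)).trans_eq ?_
    rw [Real.sq_sqrt (by positivity), neg_div, mul_div_cancel_left₀ v two_ne_zero]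
  have hupp : Real.exp (-v) / 2 ≤ stdNormalCDF 0 := by
    rw [stdNormalCDF_zero]
    gcongr
    exact Real.exp_le_one_iff.2 (by linarith)
  obtain ⟨r, hr, hΦ⟩ := intermediate_value_Icc hs continuous_stdNormalCDF.continuousOn
    ⟨hlow, hupp⟩
  have hneg : laplaceScore (-v) = r := by
    rw [laplaceScore, laplaceCDF, if_pos (by linarith), ← hΦ, stdNormalInv_stdNormalCDF]
  have hpos : laplaceScore v = -r := by
    rw [laplaceScore, laplaceCDF, if_neg (by linarith), ← hΦ, ← stdNormalCDF_neg,
      stdNormalInv_stdNormalCDF]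
  rw [hneg, hpos, neg_neg]
  exact ⟨hΦ, rfl, by linarith [hr.1]⟩

lemma tendsto_sqrt_two_mul_atTop : Tendsto (fun v : ℝ => Real.sqrt (2 * v)) atTop atTop :=
  Real.tendsto_sqrt_atTop.comp (tendsto_id.const_mul_atTop two_pos)

lemma tendsto_laplaceScore_sub_sqrt :
    Tendsto (fun v => laplaceScore v - Real.sqrt (2 * v)) atTop (𝓝 0) := by
  rw [Metric.tendsto_nhds]
  intro δ hδ
  obtain ⟨ε, hε, hεδ⟩ := exists_between hδ
  have hexp : Tendsto (fun s : ℝ => ε / Real.sqrt (2 * Real.pi) *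
      Real.exp (s * (ε / 2) + -(ε ^ 2 / 8))) atTop atTop :=
    (Real.tendsto_exp_atTop.comp (tendsto_atTop_add_const_right _ _
      (tendsto_id.atTop_mul_const (half_pos hε)))).const_mul_atTop (by positivity)
  filter_upwards [eventually_gt_atTop 0,
    tendsto_sqrt_two_mul_atTop.eventually (eventually_ge_atTop ε),
    tendsto_sqrt_two_mul_atTop.eventually (hexp.eventually (eventually_ge_atTop 1))]
    with v hv hsε hs
  obtain ⟨hΦ, -, hle⟩ := laplaceScore_spec hv
  have hsq : Real.sqrt (2 * v) ^ 2 = 2 * v := Real.sq_sqrt (by positivity)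
  set s := Real.sqrt (2 * v)
  have hlow : stdNormalCDF (-laplaceScore v) ≤ stdNormalCDF (-(s - ε)) := by
    refine le_trans ?_ (mul_density_le_stdNormalCDF (a := -(s - ε / 2)) (b := -(s - ε))
      (by linarith) (by linarith))
    have hsplit : Real.exp (-(-(s - ε / 2)) ^ 2 / 2) =
        Real.exp (-v) * Real.exp (s * (ε / 2) + -(ε ^ 2 / 8)) := by
      rw [← Real.exp_add]
      congr 1
      linear_combination (-1 / 2) * hsq
    rw [hΦ, hsplit]
    calc Real.exp (-v) / 2 = Real.exp (-v) / 2 * 1 := (mul_one _).symm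
      _ ≤ Real.exp (-v) / 2 * (ε / Real.sqrt (2 * Real.pi) *
          Real.exp (s * (ε / 2) + -(ε ^ 2 / 8))) := by gcongr
      _ = _ := by ring
  have h := strictMono_stdNormalCDF.le_iff_le.1 hlow
  rw [Real.dist_eq, sub_zero, abs_lt]
  constructor <;> linarith

lemma tendsto_quadratic_perturbation_atTop {a : ℝ} (ha : 0 < a) (c : ℝ) :
    Tendsto (fun v : ℝ => a ^ 2 * v + c * Real.sqrt v) atTop atTop := by
  have h : Tendsto (fun w : ℝ => w * (a ^ 2 * w + c)) atTop atTop :=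
    tendsto_id.atTop_mul_atTop₀ (tendsto_atTop_add_const_right _ _
      (tendsto_id.const_mul_atTop (by positivity)))
  refine (h.comp Real.tendsto_sqrt_atTop).congr' ?_
  filter_upwards [eventually_ge_atTop 0] with v hv
  have := Real.sq_sqrt hv
  dsimp only [Function.comp]
  linear_combination a ^ 2 * this

lemma tendsto_sqrt_quadratic_sub {a : ℝ} (ha : 0 < a) (c : ℝ) :
    Tendsto (fun v : ℝ => Real.sqrt (2 * (a ^ 2 * v + c * Real.sqrt v)) -
      a * Real.sqrt (2 * v)) atTop (𝓝 (c / (Real.sqrt 2 * a))) := by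
  have hinv : Tendsto (fun v : ℝ => (Real.sqrt v)⁻¹) atTop (𝓝 0) :=
    tendsto_inv_atTop_zero.comp Real.tendsto_sqrt_atTop
  have hroot : Tendsto (fun v : ℝ => Real.sqrt (2 * (a ^ 2 + c * (Real.sqrt v)⁻¹))) atTop
      (𝓝 (Real.sqrt 2 * a)) := by
    have h := (Real.continuous_sqrt.tendsto _).comp
      (((hinv.const_mul c).const_add (a ^ 2)).const_mul 2)
    simpa [Function.comp_def, Real.sqrt_mul, Real.sqrt_sq ha.le] using h
  have hs2 : Real.sqrt 2 ^ 2 = 2 := Real.sq_sqrt two_pos.le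
  have hquot : Tendsto (fun v : ℝ => 2 * c /
      (Real.sqrt (2 * (a ^ 2 + c * (Real.sqrt v)⁻¹)) + Real.sqrt 2 * a)) atTop
      (𝓝 (c / (Real.sqrt 2 * a))) := by
    have h := (tendsto_const_nhds (x := 2 * c)).div
      (hroot.add_const (Real.sqrt 2 * a)) (by positivity)
    rwa [← two_mul, mul_div_mul_left _ _ two_ne_zero] at h
  refine hquot.congr' ?_
  filter_upwards [eventually_gt_atTop 0,
    (tendsto_quadratic_perturbation_atTop ha c).eventually (eventually_ge_atTop 0)] with v hv hq
  have hw : 0 < Real.sqrt v := Real.sqrt_pos.2 hv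
  have hwsq : Real.sqrt v ^ 2 = v := Real.sq_sqrt hv.le
  rw [Real.sqrt_mul two_pos.le v]
  set w := Real.sqrt v
  have hfac : 2 * (a ^ 2 * v + c * w) = w ^ 2 * (2 * (a ^ 2 + c * w⁻¹)) := by
    rw [← hwsq]
    field_simp
  have hnn : 0 ≤ 2 * (a ^ 2 + c * w⁻¹) := by
    refine nonneg_of_mul_nonneg_right (a := w ^ 2) ?_ (by positivity)
    rw [← hfac]
    positivity
  rw [hfac, Real.sqrt_mul (sq_nonneg w), Real.sqrt_sq hw.le]
  have hrsq := Real.sq_sqrt hnn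
  have hr := Real.sqrt_nonneg (2 * (a ^ 2 + c * w⁻¹))
  set R := Real.sqrt (2 * (a ^ 2 + c * w⁻¹))
  have hden : R + Real.sqrt 2 * a ≠ 0 := by positivity
  rw [div_eq_iff hden]
  have hcw : c * w⁻¹ * w = c := by field_simp
  linear_combination (-w) * hrsq + w * a ^ 2 * hs2 - 2 * hcw

lemma tendsto_laplaceScore_quadratic_sub {a : ℝ} (ha : 0 < a) (c : ℝ) :
    Tendsto (fun v : ℝ => laplaceScore (a ^ 2 * v + c * Real.sqrt v) - a * laplaceScore v)
      atTop (𝓝 (c / (Real.sqrt 2 * a))) := by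
  have h := ((tendsto_laplaceScore_sub_sqrt.comp
    (tendsto_quadratic_perturbation_atTop ha c)).sub
      (tendsto_laplaceScore_sub_sqrt.const_mul a)).add (tendsto_sqrt_quadratic_sub ha c)
  rw [mul_zero, sub_zero, zero_add] at h
  refine h.congr fun v => ?_
  dsimp only [Function.comp]
  ring

/-- Example (negatively dependent Gaussian transition kernel with Laplace margins):
for `ρ ∈ (-1,0)`, assumption C1 holds with `a_±(v) = -ρ²v`, `b_±(v) = |v|^{1/2}` and
`K₋ = K₊ = K`, `K(x) = Φ(x/(2ρ²(1-ρ²))^{1/2})`: the normalized distribution functions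
converge pointwise both as `v → +∞` and as `v → -∞`. -/
theorem extreme_events_gauss_laplace_negdep
    (ρ : ℝ) (hρ : ρ ∈ Set.Ioo (-1 : ℝ) 0) :
    ∀ x : ℝ,
      Tendsto (fun v => gaussLaplaceKernelCDF ρ v (-ρ ^ 2 * v + Real.sqrt |v| * x)) atTop
        (𝓝 (stdNormalCDF (x / Real.sqrt (2 * ρ ^ 2 * (1 - ρ ^ 2))))) ∧
      Tendsto (fun v => gaussLaplaceKernelCDF ρ v (-ρ ^ 2 * v + Real.sqrt |v| * x)) atBot
        (𝓝 (stdNormalCDF (x / Real.sqrt (2 * ρ ^ 2 * (1 - ρ ^ 2))))) := by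
  intro x
  obtain ⟨hρ1, hρ0⟩ := hρ
  have ha : 0 < -ρ := by linarith
  have hroot : Real.sqrt (2 * ρ ^ 2 * (1 - ρ ^ 2)) =
      Real.sqrt 2 * -ρ * Real.sqrt (1 - ρ ^ 2) := by
    rw [Real.sqrt_mul (by positivity), Real.sqrt_mul two_pos.le, ← neg_sq, Real.sqrt_sq ha.le]
  rw [hroot, ← div_div]
  have hkernel {l : Filter ℝ} (h : Tendsto (fun v =>
      laplaceScore (-ρ ^ 2 * v + Real.sqrt |v| * x) - ρ * laplaceScore v) l
      (𝓝 (x / (Real.sqrt 2 * -ρ)))) :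
      Tendsto (fun v => gaussLaplaceKernelCDF ρ v (-ρ ^ 2 * v + Real.sqrt |v| * x)) l
        (𝓝 (stdNormalCDF (x / (Real.sqrt 2 * -ρ) / Real.sqrt (1 - ρ ^ 2)))) :=
    (continuous_stdNormalCDF.tendsto _).comp (h.div_const _)
  constructor <;> apply hkernel
  · have h := (tendsto_laplaceScore_quadratic_sub ha (-x)).neg
    rw [neg_div, neg_neg] at h
    refine h.congr' ?_
    filter_upwards [eventually_ge_atTop 0, (tendsto_quadratic_perturbation_atTop ha
      (-x)).eventually (eventually_gt_atTop 0)] with v hv hq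
    rw [abs_of_nonneg hv, show -ρ ^ 2 * v + Real.sqrt v * x =
      -((-ρ) ^ 2 * v + -x * Real.sqrt v) by ring, (laplaceScore_spec hq).2.1]
    ring
  · have h := (tendsto_laplaceScore_quadratic_sub ha x).comp tendsto_neg_atBot_atTop
    refine h.congr' ?_
    filter_upwards [eventually_lt_atBot 0] with v hv
    have hodd := (laplaceScore_spec (neg_pos.2 hv)).2.1
    rw [neg_neg] at hodd
    rw [Function.comp_apply, abs_of_neg hv, hodd, show -ρ ^ 2 * v + Real.sqrt (-v) * x =
      (-ρ) ^ 2 * -v + x * Real.sqrt (-v) by ring]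
    ring
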